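/- arXiv:2210.01255 — 2 statements merged into one kernel-verified Lean document; each statement's English description precedes it below -/
import Mathlib

section
/- Let ξ > 0 and let γ_H(y) = ξ³ π^{-3/2} e^{-ξ²|y|²} (5/2 − ξ²|y|²) for y ∈ ℝ³ (the Hasimoto screening function). Then for every x ∈ ℝ³, the convolution of the biharmonic kernel |·| with γ_H satisfies ∫_{ℝ³} |x − y| γ_H(y) dy = |x| erf(ξ|x|) + e^{-ξ²|x|²} / (√π ξ). -/
open MeasureTheory

/-- The error function `erf t = (2/√π) ∫₀ᵗ e^{-s²} ds`. -/
noncomputable def erf (t : ℝ) : ℝ :=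
  (2 / Real.sqrt Real.pi) * ∫ s in (0:ℝ)..t, Real.exp (-(s ^ 2))

open Set Filter Topology

local notation "E3" => EuclideanSpace ℝ (Fin 3)

lemma hs_intg_pow (b : ℝ) (hb : 0 < b) (k : ℕ) :
    Integrable (fun y : E3 => ‖y‖ ^ k * Real.exp (-b * ‖y‖ ^ 2)) := by
  have := (integrable_fun_norm_addHaar (volume : Measure E3)
    (f := fun r : ℝ => r ^ k * Real.exp (-b * r ^ 2))).2 ?_
  · exact this
  · have h := integrableOn_rpow_mul_exp_neg_mul_sq hb (s := ((k + 2 : ℕ) : ℝ))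
      (by have : (0:ℝ) ≤ ((k + 2 : ℕ) : ℝ) := Nat.cast_nonneg _
          linarith)
    refine h.congr_fun ?_ measurableSet_Ioi
    intro r hr
    simp only [Real.rpow_natCast, finrank_euclideanSpace_fin, smul_eq_mul]
    ring

lemma hs_second (b : ℝ) (hb : 0 < b) :
    ∫ y : E3, ‖y‖ ^ 2 * Real.exp (-b * ‖y‖ ^ 2) =
      3 / (2 * b) * ∫ y : E3, Real.exp (-b * ‖y‖ ^ 2) := by
  rw [integral_fun_norm_addHaar (volume : Measure E3) (fun r : ℝ => r ^ 2 * Real.exp (-b * r ^ 2)),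
    integral_fun_norm_addHaar (volume : Measure E3) (fun r : ℝ => Real.exp (-b * r ^ 2))]
  have h4 := integral_rpow_mul_exp_neg_mul_rpow (p := 2) (q := 4) (b := b)
    (by norm_num) (by norm_num) hb
  have h2 := integral_rpow_mul_exp_neg_mul_rpow (p := 2) (q := 2) (b := b)
    (by norm_num) (by norm_num) hb
  have e4 : ∫ y in Ioi (0:ℝ), y ^ (Module.finrank ℝ E3 - 1) • (y ^ 2 * Real.exp (-b * y ^ 2)) =
      ∫ x in Ioi (0 : ℝ), x ^ (4:ℝ) * Real.exp (-b * x ^ (2:ℝ)) := by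
    refine setIntegral_congr_fun measurableSet_Ioi ?_
    intro r hr
    simp only [finrank_euclideanSpace_fin, smul_eq_mul, Real.rpow_ofNat]
    ring
  have e2 : ∫ y in Ioi (0:ℝ), y ^ (Module.finrank ℝ E3 - 1) • (Real.exp (-b * y ^ 2)) =
      ∫ x in Ioi (0 : ℝ), x ^ (2:ℝ) * Real.exp (-b * x ^ (2:ℝ)) := by
    refine setIntegral_congr_fun measurableSet_Ioi ?_
    intro r hr
    simp only [finrank_euclideanSpace_fin, smul_eq_mul, Real.rpow_ofNat]
  rw [e4, e2, h4, h2]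
  have g : Real.Gamma ((4 + 1) / 2) = 3 / 2 * Real.Gamma ((2 + 1) / 2) := by
    rw [show ((4:ℝ) + 1) / 2 = 3 / 2 + 1 by norm_num, Real.Gamma_add_one (by norm_num)]
    norm_num
  have p : b ^ (-((4:ℝ) + 1) / 2) = b ^ (-((2:ℝ) + 1) / 2) / b := by
    rw [← Real.rpow_sub_one hb.ne']
    norm_num
  rw [g, p]
  simp only [smul_eq_mul, nsmul_eq_mul]
  field_simp

lemma hs_zeroth (b s : ℝ) (hs : 0 < s) (hb : b = s ^ 2) :
    ∫ y : E3, Real.exp (-b * ‖y‖ ^ 2) = Real.pi ^ ((3:ℝ) / 2) / s ^ 3 := by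
  have hb0 : 0 < b := by rw [hb]; positivity
  rw [GaussianFourier.integral_rexp_neg_mul_sq_norm hb0, finrank_euclideanSpace_fin,
    Real.div_rpow Real.pi_pos.le hb0.le, hb, ← Real.rpow_natCast s 2, ← Real.rpow_mul hs.le,
    ← Real.rpow_natCast s 3]
  norm_num

lemma hs_shift (b p q : ℝ) (hb : 0 < b) (z : E3) :
    ∫ y : E3, Real.exp (-b * ‖y - z‖ ^ 2) * (p - q * ‖y‖ ^ 2) =
      (p - q * (3 / (2 * b) + ‖z‖ ^ 2)) * ∫ y : E3, Real.exp (-b * ‖y‖ ^ 2) := by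
  rw [← integral_add_right_eq_self (μ := (volume : Measure E3)) _ z]
  have i0 : Integrable (fun y : E3 => Real.exp (-b * ‖y‖ ^ 2)) := by
    simpa using hs_intg_pow b hb 0
  have i2 := hs_intg_pow b hb 2
  have i1 : Integrable (fun y : E3 => inner ℝ y z * Real.exp (-b * ‖y‖ ^ 2)) := by
    refine ((hs_intg_pow b hb 1).const_mul ‖z‖).mono' (by fun_prop) ?_
    refine ae_of_all _ fun y => ?_
    rw [norm_mul, Real.norm_of_nonneg (Real.exp_pos _).le, pow_one, ← mul_assoc]
    gcongr
    rw [mul_comm]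
    exact norm_inner_le_norm y z
  have odd : ∫ y : E3, inner ℝ y z * Real.exp (-b * ‖y‖ ^ 2) = 0 := by
    have h := integral_neg_eq_self (fun y : E3 => inner ℝ y z * Real.exp (-b * ‖y‖ ^ 2)) volume
    simp only [inner_neg_left, norm_neg, neg_mul, integral_neg] at h
    simp only [neg_mul]
    linarith
  have key : ∀ y : E3, Real.exp (-b * ‖y + z - z‖ ^ 2) * (p - q * ‖y + z‖ ^ 2) =
      (p - q * ‖z‖ ^ 2) * Real.exp (-b * ‖y‖ ^ 2) -
      q * (‖y‖ ^ 2 * Real.exp (-b * ‖y‖ ^ 2)) -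
      (2 * q) * (inner ℝ y z * Real.exp (-b * ‖y‖ ^ 2)) := by
    intro y
    rw [add_sub_cancel_right, norm_add_sq_real]
    ring
  simp_rw [key]
  have i3 : Integrable (fun y : E3 => (p - q * ‖z‖ ^ 2) * Real.exp (-b * ‖y‖ ^ 2) -
      q * (‖y‖ ^ 2 * Real.exp (-b * ‖y‖ ^ 2))) := (i0.const_mul _).sub (i2.const_mul _)
  rw [integral_sub i3 (i1.const_mul _),
    integral_sub (i0.const_mul _) (i2.const_mul _), integral_const_mul, integral_const_mul,
    integral_const_mul, odd, hs_second b hb]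
  ring

lemma hs_gauss (ξ : ℝ) (hξ : 0 < ξ) (x : E3) (t s : ℝ) (hs : 0 < s) (hst : s ^ 2 = ξ ^ 2 + t ^ 2) :
    ∫ y : E3, Real.exp (-(t ^ 2 * ‖x - y‖ ^ 2)) *
      (ξ ^ 3 * Real.pi ^ (-(3:ℝ)/2) * Real.exp (-(ξ ^ 2 * ‖y‖ ^ 2)) *
      (5 / 2 - ξ ^ 2 * ‖y‖ ^ 2)) =
    ξ ^ 3 / s ^ 3 * Real.exp (-(ξ ^ 2 * ‖x‖ ^ 2) * (t / s) ^ 2) *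
      (5 / 2 - 3 / 2 * ξ ^ 2 / s ^ 2 - ξ ^ 2 * ‖x‖ ^ 2 * t ^ 4 / s ^ 4) := by
  have key : ∀ y : E3, Real.exp (-(t ^ 2 * ‖x - y‖ ^ 2)) *
      (ξ ^ 3 * Real.pi ^ (-(3:ℝ)/2) * Real.exp (-(ξ ^ 2 * ‖y‖ ^ 2)) *
      (5 / 2 - ξ ^ 2 * ‖y‖ ^ 2)) =
      (ξ ^ 3 * Real.pi ^ (-(3:ℝ)/2) * Real.exp (-(ξ ^ 2 * ‖x‖ ^ 2) * (t / s) ^ 2)) *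
      (Real.exp (-(s ^ 2) * ‖y - (t ^ 2 / s ^ 2) • x‖ ^ 2) * (5 / 2 - ξ ^ 2 * ‖y‖ ^ 2)) := by
    intro y
    have : Real.exp (-(t ^ 2 * ‖x - y‖ ^ 2)) * Real.exp (-(ξ ^ 2 * ‖y‖ ^ 2)) =
       Real.exp (-(ξ ^ 2 * ‖x‖ ^ 2) * (t / s) ^ 2) *
       Real.exp (-(s ^ 2) * ‖y - (t ^ 2 / s ^ 2) • x‖ ^ 2) := by
      rw [← Real.exp_add, ← Real.exp_add, norm_sub_sq_real, norm_sub_sq_real, inner_smul_right,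
        norm_smul, real_inner_comm y x, mul_pow, Real.norm_eq_abs, sq_abs]
      congr 1
      have : ξ ^ 2 = s ^ 2 - t ^ 2 := by linarith
      rw [this]
      field_simp
      ring
    linear_combination (ξ ^ 3 * Real.pi ^ (-(3:ℝ)/2) * (5 / 2 - ξ ^ 2 * ‖y‖ ^ 2)) * this
  simp_rw [key]
  rw [integral_const_mul, hs_shift _ _ _ (by positivity), hs_zeroth _ s hs rfl, norm_smul, mul_pow,
    Real.norm_eq_abs, sq_abs]
  have hpi : Real.pi ^ (-(3:ℝ)/2) = (Real.pi ^ ((3:ℝ)/2))⁻¹ := by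
    rw [← Real.rpow_neg Real.pi_pos.le]; norm_num
  have : 0 < Real.pi ^ ((3:ℝ)/2) := by positivity
  rw [hpi]
  field_simp
  ring

lemma hs_dslope (F : ℝ → ℝ) (h0 : F 0 = 1) (h : HasDerivAt F 0 0) :
    ContinuousAt (fun t => (F t - 1) / t) 0 := by
  rw [← continuousWithinAt_compl_self]
  have := hasDerivAt_iff_tendsto_slope.1 h
  unfold ContinuousWithinAt
  simp only [div_zero]
  refine this.congr fun t => ?_
  simp [slope_def_field, h0]

lemma hs_prim (c T : ℝ) : HasDerivAt (fun t => ∫ u in (0:ℝ)..t, Real.exp (-c * u ^ 2))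
    (Real.exp (-c * T ^ 2)) T := by
  have hc : Continuous (fun u : ℝ => Real.exp (-c * u ^ 2)) := by fun_prop
  exact intervalIntegral.integral_hasDerivAt_right (hc.intervalIntegrable _ _)
    (hc.stronglyMeasurableAtFilter _ _) hc.continuousAt

lemma hs_sub (r : ℝ) (hr : 0 ≤ r) :
    IntegrableOn (fun t : ℝ => (1 - Real.exp (-(t ^ 2 * r ^ 2))) / t ^ 2) (Ioi 0) ∧
    ∫ t in Ioi (0:ℝ), (1 - Real.exp (-(t ^ 2 * r ^ 2))) / t ^ 2 = Real.sqrt Real.pi * r := by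
  rcases hr.eq_or_lt with rfl | hr
  · simp
  set P : ℝ → ℝ := fun t => (Real.exp (-r ^ 2 * t ^ 2) - 1) / t +
    2 * r ^ 2 * ∫ u in (0:ℝ)..t, Real.exp (-r ^ 2 * u ^ 2) with hP
  have hE : ∀ t : ℝ, HasDerivAt (fun t => Real.exp (-r ^ 2 * t ^ 2))
      (Real.exp (-r ^ 2 * t ^ 2) * (-r ^ 2 * (2 * t))) t := by
    intro t
    have := ((hasDerivAt_pow 2 t).const_mul (-r ^ 2)).exp
    simpa using this
  have hcont : ContinuousWithinAt P (Ici 0) 0 := by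
    refine (ContinuousAt.add ?_ ?_).continuousWithinAt
    · exact hs_dslope _ (by simp) (by simpa using hE 0)
    · exact ((hs_prim (r ^ 2) 0).const_mul (2 * r ^ 2)).continuousAt
  have hderiv : ∀ t ∈ Ioi (0:ℝ), HasDerivAt P ((1 - Real.exp (-(t ^ 2 * r ^ 2))) / t ^ 2) t := by
    intro t ht
    have ht' : t ≠ 0 := ne_of_gt ht
    have := (((hE t).sub_const 1).div (hasDerivAt_id t) ht').add
      ((hs_prim (r ^ 2) t).const_mul (2 * r ^ 2))
    convert! this using 1
    rw [show -(t ^ 2 * r ^ 2) = -r ^ 2 * t ^ 2 by ring]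
    simp only [id]
    field_simp
    ring
  have hpos : ∀ t ∈ Ioi (0:ℝ), 0 ≤ (1 - Real.exp (-(t ^ 2 * r ^ 2))) / t ^ 2 := by
    intro t ht
    have : Real.exp (-(t ^ 2 * r ^ 2)) ≤ 1 := Real.exp_le_one_iff.2 (by nlinarith [sq_nonneg (t * r)])
    exact div_nonneg (by linarith) (sq_nonneg _)
  have hlim : Tendsto P atTop (𝓝 (Real.sqrt Real.pi * r)) := by
    have l1 : Tendsto (fun t : ℝ => (Real.exp (-r ^ 2 * t ^ 2) - 1) / t) atTop (𝓝 0) := by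
      refine squeeze_zero_norm' (a := fun t : ℝ => t⁻¹) ?_ tendsto_inv_atTop_zero
      filter_upwards [eventually_gt_atTop 0] with t ht
      rw [norm_div, Real.norm_of_nonneg ht.le, div_eq_mul_inv]
      have h1 : Real.exp (-r ^ 2 * t ^ 2) ≤ 1 :=
        Real.exp_le_one_iff.2 (by nlinarith [sq_nonneg (t * r)])
      have h2 := Real.exp_pos (-r ^ 2 * t ^ 2)
      have : ‖Real.exp (-r ^ 2 * t ^ 2) - 1‖ ≤ 1 := by
        rw [Real.norm_eq_abs, abs_le]; constructor <;> linarith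
      have ht2 : 0 ≤ t⁻¹ := by positivity
      nlinarith
    have l2 := intervalIntegral_tendsto_integral_Ioi (f := fun u : ℝ => Real.exp (-r ^ 2 * u ^ 2))
      (μ := volume) 0 (integrable_exp_neg_mul_sq (b := r ^ 2) (by positivity)).integrableOn tendsto_id
    have l3 := l1.add (l2.const_mul (2 * r ^ 2))
    rw [integral_gaussian_Ioi] at l3
    convert! l3 using 2
    rw [Real.sqrt_div Real.pi_pos.le, Real.sqrt_sq hr.le]
    field_simp
    ring
  refine ⟨integrableOn_Ioi_deriv_of_nonneg hcont hderiv hpos hlim, ?_⟩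
  rw [integral_Ioi_of_hasDerivAt_of_nonneg hcont hderiv hpos hlim]
  simp [hP]

lemma hs_final (ξ R : ℝ) (hξ : 0 < ξ) (H : ℝ → ℝ)
    (hH : ∀ t s : ℝ, 0 < s → s ^ 2 = ξ ^ 2 + t ^ 2 → H t =
      ξ ^ 3 / s ^ 3 * Real.exp (-(ξ ^ 2 * R ^ 2) * (t / s) ^ 2) *
      (5 / 2 - 3 / 2 * ξ ^ 2 / s ^ 2 - ξ ^ 2 * R ^ 2 * t ^ 4 / s ^ 4))
    (hint : IntegrableOn (fun t => (1 - H t) / t ^ 2) (Ioi 0)) :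
    ∫ t in Ioi (0:ℝ), (1 - H t) / t ^ 2 = Real.sqrt Real.pi *
      (R * erf (ξ * R) + Real.exp (-(ξ ^ 2 * R ^ 2)) / (Real.sqrt Real.pi * ξ)) := by
  set q := ξ ^ 2 * R ^ 2 with hq
  set S : ℝ → ℝ := fun t => Real.sqrt (ξ ^ 2 + t ^ 2) with hS
  have hSpos : ∀ t, 0 < S t := fun t => Real.sqrt_pos.2 (by positivity)
  have hSsq : ∀ t, S t ^ 2 = ξ ^ 2 + t ^ 2 := fun t => Real.sq_sqrt (by positivity)
  have hSd : ∀ t, HasDerivAt S (t / S t) t := by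
    intro t
    have h := ((hasDerivAt_pow 2 t).const_add (ξ ^ 2)).sqrt (by positivity)
    convert! h using 1
    have := (hSpos t).ne'
    simp only [hS] at this ⊢
    field_simp
    norm_num
    ring
  have hTd : ∀ t, HasDerivAt (fun t => t / S t) (ξ ^ 2 / S t ^ 3) t := by
    intro t
    have h := (hasDerivAt_id t).div (hSd t) (hSpos t).ne'
    convert! h using 1
    have := (hSpos t).ne'
    simp only [id]
    field_simp
    linarith [hSsq t]
  set K : ℝ → ℝ := fun v => ∫ u in (0:ℝ)..v, Real.exp (-q * u ^ 2) with hK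
  have hKd : ∀ v, HasDerivAt K (Real.exp (-q * v ^ 2)) v := hs_prim q
  have hEd : ∀ v : ℝ, HasDerivAt (fun v => Real.exp (-q * v ^ 2))
      (Real.exp (-q * v ^ 2) * (-q * (2 * v))) v := by
    intro v
    have := ((hasDerivAt_pow 2 v).const_mul (-q)).exp
    simpa using this
  set Q : ℝ → ℝ := fun v => Real.exp (-q * v ^ 2) * (v⁻¹ - v / 2 + v ^ 3 / 2) + 2 * q * K v with hQ
  have hQd : ∀ v, v ≠ 0 → HasDerivAt Q
      (-(Real.exp (-q * v ^ 2) * (1 - v ^ 2) * ((v ^ 2)⁻¹ + 3 / 2 - q * v ^ 2))) v := by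
    intro v hv
    have h := ((hEd v).mul (((hasDerivAt_inv hv).sub ((hasDerivAt_id v).div_const 2)).add
      ((hasDerivAt_pow 3 v).div_const 2))).add ((hKd v).const_mul (2 * q))
    convert! h using 1
    simp only [id, Pi.add_apply, Pi.sub_apply]
    field_simp
    push_cast
    ring
  set P : ℝ → ℝ := fun t => (S t / ξ * Real.exp (-q * (t / S t) ^ 2) - 1) / t +
    ξ⁻¹ * (Real.exp (-q * (t / S t) ^ 2) * (- (t / S t) / 2 + (t / S t) ^ 3 / 2) +
      2 * q * K (t / S t)) with hP
  have hPQ : ∀ t, t ≠ 0 → P t = -t⁻¹ + ξ⁻¹ * Q (t / S t) := by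
    intro t ht
    have := (hSpos t).ne'
    simp only [hP, hQ]
    field_simp
    ring
  have hS0 : S 0 = ξ := by simp [hS, Real.sqrt_sq hξ.le]
  have hET : ∀ t, HasDerivAt (fun t => Real.exp (-q * (t / S t) ^ 2))
      (Real.exp (-q * (t / S t) ^ 2) * (-q * (2 * (t / S t))) * (ξ ^ 2 / S t ^ 3)) t :=
    fun t => HasDerivAt.comp (h₂ := fun v => Real.exp (-q * v ^ 2)) t (hEd (t / S t)) (hTd t)
  have hcont : ContinuousWithinAt P (Ici 0) 0 := by
    refine (ContinuousAt.add ?_ ?_).continuousWithinAt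
    · refine hs_dslope _ (by simp [hS0, hξ.ne']) ?_
      have h := ((hSd 0).div_const ξ).mul (hET 0)
      convert! h using 1
      simp
    · have c1 := (hTd 0).continuousAt
      have c2 := (hET 0).continuousAt
      have c3 : ContinuousAt (fun t => K (t / S t)) 0 :=
        ContinuousAt.comp (g := K) (hKd (0 / S 0)).continuousAt c1
      exact ((c2.mul ((c1.neg.div_const 2).add ((c1.pow 3).div_const 2))).add
        (c3.const_mul (2 * q))).const_mul ξ⁻¹
  have hP0 : P 0 = 0 := by simp [hP, hK]
  have hderiv : ∀ t ∈ Ioi (0:ℝ), HasDerivAt P ((1 - H t) / t ^ 2) t := by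
    intro t ht
    have ht' : t ≠ 0 := ne_of_gt ht
    have hs := hSpos t
    have h := (hasDerivAt_inv ht').neg.add
      (((hQd (t / S t) (div_ne_zero ht' hs.ne')).comp t (hTd t)).const_mul ξ⁻¹)
    have h' : HasDerivAt P _ t := h.congr_of_eventuallyEq (by
      filter_upwards [isOpen_ne.mem_nhds ht'] with u hu
      exact hPQ u hu)
    convert! h' using 1
    rw [hH t (S t) hs (hSsq t)]
    have e : t ^ 2 = S t ^ 2 - ξ ^ 2 := by linarith [hSsq t]
    have e1 : 1 - (t / S t) ^ 2 = ξ ^ 2 / S t ^ 2 := by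
      field_simp; linarith [hSsq t]
    have e2 : 3 / 2 * ξ ^ 2 / S t ^ 2 = 3 / 2 * (1 - (t / S t) ^ 2) := by rw [e1]; ring
    rw [e1, e2]
    field_simp
    ring
  have hT1 : Tendsto (fun t => t / S t) atTop (𝓝 1) := by
    have c : Tendsto (fun t : ℝ => (Real.sqrt (ξ ^ 2 * (t⁻¹) ^ 2 + 1))⁻¹) atTop
        (𝓝 (Real.sqrt (ξ ^ 2 * 0 ^ 2 + 1))⁻¹) :=
      (((((tendsto_inv_atTop_zero (𝕜 := ℝ)).pow 2).const_mul (ξ ^ 2)).add_const 1).sqrt).inv₀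
        (by simp)
    have e : (Real.sqrt (ξ ^ 2 * 0 ^ 2 + 1))⁻¹ = 1 := by simp
    rw [e] at c
    refine c.congr' ?_
    filter_upwards [eventually_gt_atTop 0] with t ht
    have : S t = t * Real.sqrt (ξ ^ 2 * (t⁻¹) ^ 2 + 1) := by
      simp only [hS]
      rw [show ξ ^ 2 + t ^ 2 = t ^ 2 * (ξ ^ 2 * (t⁻¹) ^ 2 + 1) by field_simp,
        Real.sqrt_mul (sq_nonneg t), Real.sqrt_sq ht.le]
    rw [this]
    have : Real.sqrt (ξ ^ 2 * (t⁻¹) ^ 2 + 1) ≠ 0 := (Real.sqrt_pos.2 (by positivity)).ne'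
    field_simp
  have hlim : Tendsto P atTop (𝓝 (-0 + ξ⁻¹ * Q 1)) := by
    have h := (tendsto_inv_atTop_zero (𝕜 := ℝ)).neg.add
      (((hQd 1 one_ne_zero).continuousAt.tendsto.comp hT1).const_mul ξ⁻¹)
    refine h.congr' ?_
    filter_upwards [eventually_gt_atTop 0] with t ht
    exact (hPQ t ht.ne').symm
  rw [integral_Ioi_of_hasDerivAt_of_tendsto hcont hderiv hint hlim, hP0]
  have hK1 : ξ * R * K 1 = ∫ s in (0:ℝ)..(ξ * R), Real.exp (-(s ^ 2)) := by
    have h := intervalIntegral.mul_integral_comp_mul_left (a := 0) (b := 1)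
      (f := fun s : ℝ => Real.exp (-(s ^ 2))) (c := ξ * R)
    rw [mul_zero, mul_one] at h
    rw [← h]
    simp only [hK, hq]
    congr 2
    ext u
    congr 1
    ring
  have hpi : Real.sqrt Real.pi ≠ 0 := (Real.sqrt_pos.2 Real.pi_pos).ne'
  unfold erf
  rw [← hK1]
  simp only [hQ]
  rw [one_pow, mul_one]
  rw [hq]
  field_simp
  ring

lemma hs_int_gamma (ξ : ℝ) (hξ : 0 < ξ) (C : ℝ) (x : E3) :
    Integrable (fun y : E3 => C * Real.exp (-(ξ ^ 2 * ‖y‖ ^ 2)) * (5 / 2 - ξ ^ 2 * ‖y‖ ^ 2)) ∧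
    Integrable (fun y : E3 => ‖x - y‖ *
      (C * Real.exp (-(ξ ^ 2 * ‖y‖ ^ 2)) * (5 / 2 - ξ ^ 2 * ‖y‖ ^ 2))) := by
  have hb : 0 < ξ ^ 2 := by positivity
  have i := hs_intg_pow (ξ ^ 2) hb
  have iγ : Integrable (fun y : E3 =>
      C * Real.exp (-(ξ ^ 2 * ‖y‖ ^ 2)) * (5 / 2 - ξ ^ 2 * ‖y‖ ^ 2)) := by
    refine (((i 0).const_mul (C * 5 / 2)).sub ((i 2).const_mul (C * ξ ^ 2))).congr ?_
    refine ae_of_all _ fun y => ?_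
    simp only [Pi.sub_apply, neg_mul]
    ring
  have iγ' : Integrable (fun y : E3 => ‖y‖ *
      (C * Real.exp (-(ξ ^ 2 * ‖y‖ ^ 2)) * (5 / 2 - ξ ^ 2 * ‖y‖ ^ 2))) := by
    refine (((i 1).const_mul (C * 5 / 2)).sub ((i 3).const_mul (C * ξ ^ 2))).congr ?_
    refine ae_of_all _ fun y => ?_
    simp only [Pi.sub_apply, neg_mul]
    ring
  refine ⟨iγ, ((iγ.norm.const_mul ‖x‖).add iγ'.norm).mono' (by fun_prop) ?_⟩
  refine ae_of_all _ fun y => ?_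
  simp only [Pi.add_apply]
  rw [norm_mul, norm_mul ‖y‖, norm_norm, norm_norm, ← add_mul]
  exact mul_le_mul_of_nonneg_right (norm_sub_le x y) (norm_nonneg _)

/-- Convolution of the biharmonic kernel `|·|` with the Hasimoto screening function
`γ_H(y) = ξ³ π^{-3/2} e^{-ξ²|y|²} (5/2 − ξ²|y|²)` equals
`|x| erf(ξ|x|) + e^{-ξ²|x|²}/(√π ξ)`. -/
theorem biharmonic_conv_hasimoto_screening (ξ : ℝ) (hξ : 0 < ξ)
    (γH : EuclideanSpace ℝ (Fin 3) → ℝ)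
    (hγH : ∀ y, γH y = ξ ^ 3 * Real.pi ^ (-(3:ℝ)/2) * Real.exp (-(ξ ^ 2 * ‖y‖ ^ 2)) *
      (5 / 2 - ξ ^ 2 * ‖y‖ ^ 2))
    (x : EuclideanSpace ℝ (Fin 3)) :
    (∫ y, ‖x - y‖ * γH y) =
      ‖x‖ * erf (ξ * ‖x‖) + Real.exp (-(ξ ^ 2 * ‖x‖ ^ 2)) / (Real.sqrt Real.pi * ξ) := by
  have hγ : γH = fun y => ξ ^ 3 * Real.pi ^ (-(3:ℝ)/2) * Real.exp (-(ξ ^ 2 * ‖y‖ ^ 2)) *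
      (5 / 2 - ξ ^ 2 * ‖y‖ ^ 2) := funext hγH
  have hc : Continuous γH := by rw [hγ]; fun_prop
  obtain ⟨iγ, ixγ⟩ := hs_int_gamma ξ hξ (ξ ^ 3 * Real.pi ^ (-(3:ℝ)/2)) x
  rw [← hγ] at iγ
  simp_rw [← hγH] at ixγ
  set H : ℝ → ℝ := fun t => ∫ y, Real.exp (-(t ^ 2 * ‖x - y‖ ^ 2)) * γH y with hHdef
  have hH : ∀ t s : ℝ, 0 < s → s ^ 2 = ξ ^ 2 + t ^ 2 → H t =
      ξ ^ 3 / s ^ 3 * Real.exp (-(ξ ^ 2 * ‖x‖ ^ 2) * (t / s) ^ 2) *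
      (5 / 2 - 3 / 2 * ξ ^ 2 / s ^ 2 - ξ ^ 2 * ‖x‖ ^ 2 * t ^ 4 / s ^ 4) := by
    intro t s hs hst
    simp only [hHdef, hγH]
    exact hs_gauss ξ hξ x t s hs hst
  have hone : ∫ y, γH y = 1 := by
    have h := hH 0 ξ hξ (by ring)
    simp only [hHdef] at h
    simp only [ne_eq, OfNat.ofNat_ne_zero, not_false_eq_true, zero_pow, zero_mul, neg_zero,
      Real.exp_zero, one_mul] at h
    rw [h]
    field_simp
    norm_num
  set f : E3 → ℝ → ℝ := fun y t => γH y * ((1 - Real.exp (-(t ^ 2 * ‖x - y‖ ^ 2))) / t ^ 2) with hf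
  have hsub : ∀ y : E3, ∫ t in Ioi (0:ℝ), f y t = Real.sqrt Real.pi * (‖x - y‖ * γH y) := by
    intro y
    simp only [hf]
    rw [integral_const_mul, (hs_sub ‖x - y‖ (norm_nonneg _)).2]
    ring
  have hmeas : Measurable (Function.uncurry f) := by
    have := hc.measurable
    simp only [hf, Function.uncurry_def]
    fun_prop
  have hprod : Integrable (Function.uncurry f) (volume.prod (volume.restrict (Ioi (0:ℝ)))) := by
    rw [integrable_prod_iff hmeas.aestronglyMeasurable]
    refine ⟨ae_of_all _ fun y => ((hs_sub ‖x - y‖ (norm_nonneg _)).1).const_mul (γH y), ?_⟩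
    refine (ixγ.norm.const_mul (Real.sqrt Real.pi)).congr (ae_of_all _ fun y => ?_)
    have : ∀ t : ℝ, ‖Function.uncurry f (y, t)‖ =
        ‖γH y‖ * ((1 - Real.exp (-(t ^ 2 * ‖x - y‖ ^ 2))) / t ^ 2) := by
      intro t
      simp only [hf, Function.uncurry_apply_pair]
      rw [norm_mul, Real.norm_of_nonneg (div_nonneg _ (sq_nonneg t))]
      have : Real.exp (-(t ^ 2 * ‖x - y‖ ^ 2)) ≤ 1 :=
        Real.exp_le_one_iff.2 (by nlinarith [sq_nonneg (t * ‖x - y‖)])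
      linarith
    simp only [this]
    rw [integral_const_mul, (hs_sub ‖x - y‖ (norm_nonneg _)).2, norm_mul, norm_norm]
    ring
  have hin : ∀ t : ℝ, ∫ y, f y t = (1 - H t) / t ^ 2 := by
    intro t
    have ie : Integrable (fun y => Real.exp (-(t ^ 2 * ‖x - y‖ ^ 2)) * γH y) := by
      refine iγ.norm.mono' (by fun_prop) (ae_of_all _ fun y => ?_)
      rw [norm_mul, Real.norm_of_nonneg (Real.exp_pos _).le]
      have : Real.exp (-(t ^ 2 * ‖x - y‖ ^ 2)) ≤ 1 :=
        Real.exp_le_one_iff.2 (by nlinarith [sq_nonneg (t * ‖x - y‖)])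
      exact mul_le_of_le_one_left (norm_nonneg _) this
    have e : ∀ y, f y t = (γH y - Real.exp (-(t ^ 2 * ‖x - y‖ ^ 2)) * γH y) / t ^ 2 := by
      intro y; simp only [hf]; ring
    simp_rw [e]
    rw [integral_div, integral_sub iγ ie, hone]
  have hint : IntegrableOn (fun t => (1 - H t) / t ^ 2) (Ioi 0) := by
    have h := hprod.integral_prod_right
    simp only [Function.uncurry_apply_pair, hin] at h
    exact h
  have hfin := hs_final ξ ‖x‖ hξ H hH hint
  have hswap := integral_integral_swap hprod
  simp only [hsub, hin] at hswap
  rw [hfin, integral_const_mul] at hswap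
  exact mul_left_cancel₀ (Real.sqrt_pos.2 Real.pi_pos).ne' hswap
end

section
/- Let α > 0, ξ > 0 and r ∈ ℝ. Then (1/2π) ∫_ℝ (4π/(α² + κ²)) e^{-(α² + κ²)/(4ξ²)} e^{i κ r} dκ = (π/α) β⁺(α, r), where β⁺(α, r) = e^{α r} erfc(α/(2ξ) + ξ r) + e^{-α r} erfc(α/(2ξ) − ξ r). -/
open MeasureTheory

/-- The complementary error function `erfc t = 1 − erf t`. -/
noncomputable def erfc (t : ℝ) : ℝ := 1 - erf t

open Filter Topology in
lemma sh_erfc_tendsto : Tendsto erfc atTop (𝓝 0) := by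
  have hint : IntegrableOn (fun s : ℝ => Real.exp (-(s ^ 2))) (Set.Ioi 0) := by
    have := (integrable_exp_neg_mul_sq (b := 1) one_pos).integrableOn (s := Set.Ioi 0)
    simpa using this
  have h := intervalIntegral_tendsto_integral_Ioi 0 hint tendsto_id
  have hv : ∫ s in Set.Ioi (0:ℝ), Real.exp (-(s ^ 2)) = Real.sqrt Real.pi / 2 := by
    have := integral_gaussian_Ioi 1
    simpa using this
  rw [hv] at h
  have h2 := (h.const_mul (2 / Real.sqrt Real.pi)).const_sub 1
  have hp : Real.sqrt Real.pi ≠ 0 := (Real.sqrt_pos.2 Real.pi_pos).ne'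
  have h3 : 1 - 2 / Real.sqrt Real.pi * (Real.sqrt Real.pi / 2) = 0 := by field_simp; ring
  rw [h3] at h2
  exact h2

lemma sh_erfc_deriv (t : ℝ) :
    HasDerivAt erfc (-(2 / Real.sqrt Real.pi * Real.exp (-(t ^ 2)))) t := by
  have hc : Continuous (fun s : ℝ => Real.exp (-(s ^ 2))) := by fun_prop
  have h := (hc.integral_hasStrictDerivAt 0 t).hasDerivAt
  exact (h.const_mul (2 / Real.sqrt Real.pi)).const_sub 1

noncomputable def shG (α r u : ℝ) : ℝ :=
  Real.pi / (2 * α) * (Real.exp (α * r) * erfc (α * u + r / (2 * u))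
    + Real.exp (-(α * r)) * erfc (α * u - r / (2 * u)))

lemma shG_deriv (α r u : ℝ) (hα : 0 < α) (hu : 0 < u) :
    HasDerivAt (shG α r)
      (-(2 * Real.sqrt Real.pi * Real.exp (-(α ^ 2 * u ^ 2) - r ^ 2 / (4 * u ^ 2)))) u := by
  have hd : HasDerivAt (fun u : ℝ => r / (2 * u)) (-(r / (2 * u ^ 2))) u := by
    have h0 := (hasDerivAt_inv hu.ne').const_mul (r / 2)
    have hf : (fun u : ℝ => r / (2 * u)) = fun u : ℝ => r / 2 * u⁻¹ := by
      funext v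
      rw [← div_div, div_eq_mul_inv]
    rw [hf]
    refine h0.congr_deriv ?_
    field_simp
  have hl : HasDerivAt (fun u : ℝ => α * u) α u := by
    simpa using (hasDerivAt_id u).const_mul α
  have h1 := ((sh_erfc_deriv _).comp u (hl.add hd)).const_mul (Real.exp (α * r))
  have h2 := ((sh_erfc_deriv _).comp u (hl.sub hd)).const_mul (Real.exp (-(α * r)))
  have h := (h1.add h2).const_mul (Real.pi / (2 * α))
  refine h.congr_deriv ?_
  have e1 : Real.exp (-((α * u + r / (2 * u)) ^ 2)) =
      Real.exp (-(α ^ 2 * u ^ 2) - r ^ 2 / (4 * u ^ 2)) * Real.exp (-(α * r)) := by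
    rw [← Real.exp_add]; congr 1; field_simp; ring
  have e2 : Real.exp (-((α * u - r / (2 * u)) ^ 2)) =
      Real.exp (-(α ^ 2 * u ^ 2) - r ^ 2 / (4 * u ^ 2)) * Real.exp (α * r) := by
    rw [← Real.exp_add]; congr 1; field_simp; ring
  have e3 : Real.exp (α * r) * Real.exp (-(α * r)) = 1 := by
    rw [← Real.exp_add]; simp
  simp only [Pi.add_apply, Pi.sub_apply]
  rw [e1, e2]
  generalize Real.exp (-(α ^ 2 * u ^ 2) - r ^ 2 / (4 * u ^ 2)) = E
  have hp : Real.sqrt Real.pi ≠ 0 := (Real.sqrt_pos.2 Real.pi_pos).ne'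
  have hpp : Real.pi = Real.sqrt Real.pi * Real.sqrt Real.pi :=
    (Real.mul_self_sqrt Real.pi_pos.le).symm
  generalize Real.sqrt Real.pi = q at *
  rw [hpp]
  generalize r / (2 * u ^ 2) = w
  calc _ = -(q * E / α * (Real.exp (α * r) * Real.exp (-(α * r))) * ((α + -w) + (α - -w))) := by
        field_simp
        ring
    _ = _ := by
        rw [e3]; field_simp; ring

open Filter Topology in
lemma shG_tendsto (α r : ℝ) (hα : 0 < α) : Tendsto (shG α r) atTop (𝓝 0) := by
  have hl : Tendsto (fun u : ℝ => α * u) atTop atTop := tendsto_id.const_mul_atTop hα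
  have hd : Tendsto (fun u : ℝ => r / (2 * u)) atTop (𝓝 0) :=
    tendsto_const_nhds.div_atTop (tendsto_id.const_mul_atTop two_pos)
  have h1 := (sh_erfc_tendsto.comp (hl.atTop_add hd)).const_mul (Real.exp (α * r))
  have hd' := hd.neg
  have h2 := (sh_erfc_tendsto.comp (hl.atTop_add hd')).const_mul (Real.exp (-(α * r)))
  have h := (h1.add h2).const_mul (Real.pi / (2 * α))
  simp only [mul_zero, add_zero] at h
  refine h.congr fun u => ?_
  simp [shG, sub_eq_add_neg]

noncomputable def shI (α r u κ : ℝ) : ℂ :=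
  ((1 / (α ^ 2 + κ ^ 2) * Real.exp (-((α ^ 2 + κ ^ 2) * u ^ 2)) : ℝ) : ℂ) *
    Complex.exp (Complex.I * (κ : ℂ) * (r : ℂ))

noncomputable def shF (α r u : ℝ) : ℂ := ∫ κ : ℝ, shI α r u κ

lemma sh_norm_phase (κ r : ℝ) : ‖Complex.exp (Complex.I * (κ : ℂ) * (r : ℂ))‖ = 1 := by
  have : Complex.I * (κ : ℂ) * (r : ℂ) = ((κ * r : ℝ) : ℂ) * Complex.I := by push_cast; ring
  rw [this, Complex.norm_exp_ofReal_mul_I]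

lemma shI_norm_le (α r u κ : ℝ) (hα : 0 < α) :
    ‖shI α r u κ‖ ≤ 1 / α ^ 2 * Real.exp (-u ^ 2 * κ ^ 2) := by
  have h0 : 0 < α ^ 2 := by positivity
  rw [shI, norm_mul, sh_norm_phase, mul_one, Complex.norm_real, Real.norm_of_nonneg (by positivity)]
  gcongr
  · nlinarith [sq_nonneg κ]
  · nlinarith [mul_nonneg h0.le (sq_nonneg u)]

lemma shI_cont (α r u : ℝ) (hα : 0 < α) : Continuous (shI α r u) := by
  have : ∀ κ : ℝ, α ^ 2 + κ ^ 2 ≠ 0 := fun κ => by positivity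
  unfold shI
  fun_prop (disch := assumption)

lemma shI_int (α r u : ℝ) (hα : 0 < α) (hu : 0 < u) : Integrable (shI α r u) := by
  refine Integrable.mono' ((integrable_exp_neg_mul_sq (b := u ^ 2) (by positivity)).const_mul
    (1 / α ^ 2)) (shI_cont α r u hα).aestronglyMeasurable (ae_of_all _ fun κ => ?_)
  exact shI_norm_le α r u κ hα

open Filter Topology in
lemma shF_tendsto (α r : ℝ) (hα : 0 < α) : Tendsto (shF α r) atTop (𝓝 0) := by
  have hb : Tendsto (fun u : ℝ => 1 / α ^ 2 * (Real.sqrt Real.pi / u)) atTop (𝓝 0) := by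
    have := (tendsto_const_nhds (x := Real.sqrt Real.pi)).div_atTop (tendsto_id (α := ℝ))
    have h2 := this.const_mul (1 / α ^ 2)
    rwa [mul_zero] at h2
  refine squeeze_zero_norm' ?_ hb
  filter_upwards [eventually_gt_atTop 0] with u hu
  have hi := (integrable_exp_neg_mul_sq (b := u ^ 2) (by positivity)).const_mul (1 / α ^ 2)
  refine (norm_integral_le_of_norm_le hi (ae_of_all _ fun κ => shI_norm_le α r u κ hα)).trans ?_
  rw [integral_const_mul, integral_gaussian, Real.sqrt_div Real.pi_pos.le, Real.sqrt_sq hu.le]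

noncomputable def shI' (r α u κ : ℝ) : ℂ :=
  ((-(2 * u) * Real.exp (-((α ^ 2 + κ ^ 2) * u ^ 2)) : ℝ) : ℂ) *
    Complex.exp (Complex.I * (κ : ℂ) * (r : ℂ))

lemma shI'_integral (α r u : ℝ) (hu : 0 < u) : ∫ κ : ℝ, shI' r α u κ =
    ((-(2 * Real.sqrt Real.pi * Real.exp (-(α ^ 2 * u ^ 2) - r ^ 2 / (4 * u ^ 2))) : ℝ) : ℂ) := by
  have h := fourierIntegral_gaussian (b := ((u ^ 2 : ℝ) : ℂ))
    (by rw [Complex.ofReal_re]; positivity) (r : ℂ)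
  have e : ∀ κ : ℝ, shI' r α u κ = ((-(2 * u) * Real.exp (-(α ^ 2 * u ^ 2)) : ℝ) : ℂ) *
      (Complex.exp (Complex.I * r * κ) * Complex.exp (-((u ^ 2 : ℝ) : ℂ) * κ ^ 2)) := by
    intro κ
    have : Real.exp (-((α ^ 2 + κ ^ 2) * u ^ 2)) =
        Real.exp (-(α ^ 2 * u ^ 2)) * Real.exp (-(u ^ 2) * κ ^ 2) := by
      rw [← Real.exp_add]; congr 1; ring
    rw [shI', this, mul_right_comm Complex.I (κ : ℂ)]
    push_cast
    ring
  simp_rw [e]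
  rw [integral_const_mul, h]
  have hs : ((Real.pi : ℂ) / ((u ^ 2 : ℝ) : ℂ)) ^ (1 / 2 : ℂ) =
      ((Real.sqrt Real.pi / u : ℝ) : ℂ) := by
    rw [← Complex.ofReal_div]
    have : (1 / 2 : ℂ) = ((1 / 2 : ℝ) : ℂ) := by push_cast; rfl
    rw [this, ← Complex.ofReal_cpow (by positivity), ← Real.sqrt_eq_rpow,
      Real.sqrt_div Real.pi_pos.le, Real.sqrt_sq hu.le]
  have hx : -(r : ℂ) ^ 2 / (4 * ((u ^ 2 : ℝ) : ℂ)) = ((-(r ^ 2 / (4 * u ^ 2)) : ℝ) : ℂ) := by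
    push_cast; ring
  rw [hs, hx, ← Complex.ofReal_exp, ← Complex.ofReal_mul, ← Complex.ofReal_mul]
  congr 1
  rw [sub_eq_add_neg, Real.exp_add]
  field_simp

lemma shF_deriv (α r u : ℝ) (hα : 0 < α) (hu : 0 < u) :
    HasDerivAt (shF α r) (∫ κ : ℝ, shI' r α u κ) u := by
  have hs : Set.Ioo (u / 2) (2 * u) ∈ nhds u := Ioo_mem_nhds (by linarith) (by linarith)
  refine (hasDerivAt_integral_of_dominated_loc_of_deriv_le (F := shI α r) (F' := shI' r α)
    (bound := fun κ => 4 * u * Real.exp (-(u / 2) ^ 2 * κ ^ 2)) hs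
    (Filter.Eventually.of_forall fun x => (shI_cont α r x hα).aestronglyMeasurable)
    (shI_int α r u hα hu) ?_ (ae_of_all _ fun κ x hx => ?_)
    ((integrable_exp_neg_mul_sq (b := (u / 2) ^ 2) (by positivity)).const_mul _)
    (ae_of_all _ fun κ x _ => ?_)).2
  · have : Continuous (shI' r α u) := by unfold shI'; fun_prop
    exact this.aestronglyMeasurable
  · have hx0 : 0 < x := by linarith [hx.1]
    rw [shI', norm_mul, sh_norm_phase, mul_one, Complex.norm_real, norm_mul, norm_neg,
      Real.norm_of_nonneg (by positivity), Real.norm_of_nonneg (by positivity)]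
    refine mul_le_mul (by linarith [hx.2]) (Real.exp_le_exp.2 ?_) (by positivity) (by positivity)
    · have : (u / 2) ^ 2 ≤ x ^ 2 := by gcongr; exact hx.1.le
      nlinarith [mul_nonneg (sq_nonneg α) (sq_nonneg x),
        mul_le_mul_of_nonneg_left this (sq_nonneg κ)]
  · have hne : α ^ 2 + κ ^ 2 ≠ 0 := by positivity
    have h1 : HasDerivAt (fun x : ℝ => 1 / (α ^ 2 + κ ^ 2) *
        Real.exp (-((α ^ 2 + κ ^ 2) * x ^ 2)))
        (-(2 * x) * Real.exp (-((α ^ 2 + κ ^ 2) * x ^ 2))) x := by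
      have := ((((hasDerivAt_pow 2 x).const_mul (α ^ 2 + κ ^ 2)).neg).exp).const_mul
        (1 / (α ^ 2 + κ ^ 2))
      refine this.congr_deriv ?_
      simp only [Pi.neg_apply]
      field_simp
      simp [mul_comm]
    exact h1.ofReal_comp.mul_const _

open Filter Topology in
lemma shF_eq (α r u : ℝ) (hα : 0 < α) (hu : 0 < u) : shF α r u = ((shG α r u : ℝ) : ℂ) := by
  have hD : ∀ x ∈ Set.Ioi (0 : ℝ),
      HasDerivAt (fun x => shF α r x - ((shG α r x : ℝ) : ℂ)) 0 x := by
    intro x hx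
    have h := (shF_deriv α r x hα hx).sub (shG_deriv α r x hα hx).ofReal_comp
    rw [shI'_integral α r x hx, sub_self] at h
    exact h
  have hc : ∀ x ∈ Set.Ioi (0 : ℝ), shF α r x - ((shG α r x : ℝ) : ℂ) =
      shF α r u - ((shG α r u : ℝ) : ℂ) := fun x hx =>
    isOpen_Ioi.is_const_of_deriv_eq_zero isPreconnected_Ioi
      (fun y hy => (hD y hy).differentiableAt.differentiableWithinAt)
      (fun y hy => (hD y hy).deriv) hx hu
  have ht : Tendsto (fun x => shF α r x - ((shG α r x : ℝ) : ℂ)) atTop (𝓝 0) := by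
    have h2 := (Complex.continuous_ofReal.tendsto 0).comp (shG_tendsto α r hα)
    simpa using (shF_tendsto α r hα).sub h2
  have ht2 : Tendsto (fun x => shF α r x - ((shG α r x : ℝ) : ℂ)) atTop
      (𝓝 (shF α r u - ((shG α r u : ℝ) : ℂ))) := by
    refine tendsto_const_nhds.congr' ?_
    filter_upwards [eventually_gt_atTop 0] with x hx
    exact (hc x hx).symm
  exact sub_eq_zero.1 (tendsto_nhds_unique ht2 ht)

/-- One-dimensional inverse Fourier transform of the screened harmonic kernel at
periodic wavenumber `α`:
`(1/2π) ∫_ℝ (4π/(α²+κ²)) e^{-(α²+κ²)/(4ξ²)} e^{iκr} dκ = (π/α) β⁺(α,r)`, where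
`β⁺(α,r) = e^{αr} erfc(α/(2ξ)+ξr) + e^{-αr} erfc(α/(2ξ)−ξr)`. -/
theorem screened_harmonic_1d_inverse_fourier (α ξ r : ℝ) (hα : 0 < α) (hξ : 0 < ξ) :
    ((1 / (2 * Real.pi) : ℝ) : ℂ) *
      (∫ κ : ℝ, ((4 * Real.pi / (α ^ 2 + κ ^ 2) *
          Real.exp (-((α ^ 2 + κ ^ 2) / (4 * ξ ^ 2))) : ℝ) : ℂ) *
        Complex.exp (Complex.I * (κ : ℂ) * (r : ℂ)))
    = (((Real.pi / α) *
        (Real.exp (α * r) * erfc (α / (2 * ξ) + ξ * r)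
          + Real.exp (-(α * r)) * erfc (α / (2 * ξ) - ξ * r)) : ℝ) : ℂ) := by
  have h := shF_eq α r (1 / (2 * ξ)) hα (by positivity)
  have e : ∀ κ : ℝ, ((4 * Real.pi / (α ^ 2 + κ ^ 2) *
          Real.exp (-((α ^ 2 + κ ^ 2) / (4 * ξ ^ 2))) : ℝ) : ℂ) *
        Complex.exp (Complex.I * (κ : ℂ) * (r : ℂ)) =
      ((4 * Real.pi : ℝ) : ℂ) * shI α r (1 / (2 * ξ)) κ := by
    intro κ
    have : (α ^ 2 + κ ^ 2) / (4 * ξ ^ 2) = (α ^ 2 + κ ^ 2) * (1 / (2 * ξ)) ^ 2 := by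
      field_simp; norm_num
    rw [shI, this]
    push_cast
    ring
  simp_rw [e]
  rw [integral_const_mul]
  change _ * (_ * shF α r (1 / (2 * ξ))) = _
  rw [h, ← Complex.ofReal_mul, ← Complex.ofReal_mul]
  congr 1
  have e1 : α * (1 / (2 * ξ)) = α / (2 * ξ) := by ring
  have e2 : r / (2 * (1 / (2 * ξ))) = ξ * r := by field_simp
  rw [shG, e1, e2]
  have := Real.pi_pos
  field_simp
  ring
end
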